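/- Define the polynomial g(x,y) = 768*y - 288*x^2 - 1728*y^3 + 1944*x^2*y^2 - 891*x^4 - 2430*x^4*y - 1944*x^2*y^3 + 1296*y^4 + 729*x^4*y^2 + 729*x^6 - 256. Then the point (0, 2/3) is the unique real point (x,y) with g(x,y) = 0, ∂g/∂x(x,y) = 0 and ∂g/∂y(x,y) = 0. That is, g(0, 2/3) = 0, both partial derivatives of g vanish at (0, 2/3), and any real (x,y) satisfying all three equations equals (0, 2/3). -/

import Mathlib

/-- The polynomial defining the parallel lines at offset r = 2/3 to the parabola
4*(1/3)*y = x^2. -/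
noncomputable def g13 (x y : ℝ) : ℝ :=
  768*y - 288*x^2 - 1728*y^3 + 1944*x^2*y^2 - 891*x^4 - 2430*x^4*y - 1944*x^2*y^3 + 1296*y^4 +
    729*x^4*y^2 + 729*x^6 - 256

/-- Explicit partial derivative in `x`. -/
lemma g13_dx (x y : ℝ) : deriv (fun t : ℝ => g13 t y) x =
    x * (-576 + 3888*y^2 - 3564*x^2 - 9720*x^2*y - 3888*y^3 + 2916*x^2*y^2 + 4374*x^4) := by
  have i := hasDerivAt_id' x
  have h := ((((((i.pow 2).const_mul (-288 + 1944*y^2 - 1944*y^3)).add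
    ((i.pow 4).const_mul (-891 - 2430*y + 729*y^2))).add
    ((i.pow 6).const_mul 729)).add_const (768*y - 1728*y^3 + 1296*y^4 - 256)))
  have e : (fun t : ℝ => g13 t y) =
    (fun t : ℝ => (-288 + 1944*y^2 - 1944*y^3) * t^2
      + (-891 - 2430*y + 729*y^2) * t^4 + 729 * t^6 + (768*y - 1728*y^3 + 1296*y^4 - 256)) := by
    funext t; unfold g13; ring
  rw [e]
  refine (HasDerivAt.deriv h).trans ?_
  push_cast; ring

/-- Explicit partial derivative in `y`. -/
lemma g13_dy (x y : ℝ) : deriv (fun t : ℝ => g13 x t) y =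
    768 - 5184*y^2 + 3888*x^2*y - 2430*x^4 - 5832*x^2*y^2 + 5184*y^3 + 1458*x^4*y := by
  have i := hasDerivAt_id' y
  have h := ((((((i.pow 1).const_mul (768 - 2430*x^4)).add
    ((i.pow 2).const_mul (1944*x^2 + 729*x^4))).add
    ((i.pow 3).const_mul (-1728 - 1944*x^2))).add
    ((i.pow 4).const_mul 1296)).add_const (-288*x^2 - 891*x^4 + 729*x^6 - 256))
  have e : (fun t : ℝ => g13 x t) =
    (fun t : ℝ => (768 - 2430*x^4) * t^1
      + (1944*x^2 + 729*x^4) * t^2 + (-1728 - 1944*x^2) * t^3 + 1296 * t^4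
      + (-288*x^2 - 891*x^4 + 729*x^6 - 256)) := by
    funext t; unfold g13; ring
  rw [e]
  refine (HasDerivAt.deriv h).trans ?_
  push_cast; ring

/-- Elimination certificate in the coordinates `s = 9 x ^ 2`, `Y = 3 y`. -/
lemma certificate (s Y : ℝ)
    (hG : 256*Y - 32*s - 64*Y^3 + 24*s*Y^2 - 11*s^2 - 10*s^2*Y - 8*s*Y^3 + 16*Y^4
      + s^2*Y^2 + s^3 - 256 = 0)
    (hS : -32 + 24*Y^2 - 22*s - 20*s*Y - 8*Y^3 + 2*s*Y^2 + 3*s^2 = 0)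
    (hY : 256 - 192*Y^2 + 48*s*Y - 10*s^2 - 24*s*Y^2 + 64*Y^3 + 2*s^2*Y = 0) :
    s * (s^2 + 432)^2 = 0 := by
  linear_combination (-3392 - 3280*Y + 112*Y^2 + 432*s - 24*s*Y - 2*s^2) * hG
    + (-11392 + 7680*Y - 2304*Y^2 + 224*Y^3 + 1936*s + 1544*s*Y - 104*s*Y^2 - 144*s^2
      + 8*s^2*Y + s^3) * hS
    + (-4816 + 1072*Y + 560*Y^2) * hY

theorem parabola_critical_unique_singular_point :
    g13 0 (2/3) = 0 ∧
    deriv (fun t : ℝ => g13 t (2/3)) 0 = 0 ∧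
    deriv (fun t : ℝ => g13 0 t) (2/3) = 0 ∧
    ∀ x y : ℝ, g13 x y = 0 →
      deriv (fun t : ℝ => g13 t y) x = 0 →
      deriv (fun t : ℝ => g13 x t) y = 0 →
      (x, y) = ((0 : ℝ), (2/3 : ℝ)) := by
  refine ⟨by unfold g13; norm_num, by rw [g13_dx]; norm_num, by rw [g13_dy]; norm_num, ?_⟩
  intro x y hg hx hy
  rw [g13_dx] at hx
  rw [g13_dy] at hy
  unfold g13 at hg
  have hx0 : x = 0 := by
    rcases mul_eq_zero.mp hx with h | h
    · exact h
    · have hc := certificate (9*x^2) (3*y) (by linear_combination hg)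
        (by linear_combination h / 18) (by linear_combination hy / 3)
      have hp : ((9*x^2)^2 + 432 : ℝ)^2 ≠ 0 := by positivity
      have h9 := (mul_eq_zero.mp hc).resolve_right hp
      have : x^2 = 0 := by linarith
      exact pow_eq_zero_iff (two_ne_zero) |>.mp this
  subst hx0
  have hf : (3*y - 2)^2 = 0 := by
    linear_combination (3*y - 1) / 576 * hy - hg / 48
  have h2 : 3*y - 2 = 0 := pow_eq_zero_iff (two_ne_zero) |>.mp hf
  have : y = 2/3 := by linarith
  rw [this]
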